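/- Let (k_j)_{j=1}^J be any finite sequence of integers and f ∈ L¹(𝕋). If f̂ vanishes on Schur((k_j)), then (∑_{j=1}^J |f̂(k_j)|²)^{1/2} ≤ 2‖f‖₁. -/

import Mathlib

open MeasureTheory AddCircle

/-- The Schur set of a finite sequence `(k j)_{j=1}^J` of integers: all integers
`m = ∑_{j=1}^J ε j * k j` with integer coefficients such that the full sum of the `ε j` is `1`,
all partial sums are nonnegative, all partial sums after the first positive one are positive,
and some partial sum exceeds `1`. -/
def SchurSet (J : ℕ) (k : ℕ → ℤ) : Set ℤ :=
  {m | ∃ ε : ℕ → ℤ,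
    m = ∑ j ∈ Finset.Icc 1 J, ε j * k j ∧
    (∑ j ∈ Finset.Icc 1 J, ε j) = 1 ∧
    (∀ i, i ≤ J → 0 ≤ ∑ j ∈ Finset.Icc 1 i, ε j) ∧
    (∀ i i', i ≤ i' → i' ≤ J → 0 < ∑ j ∈ Finset.Icc 1 i, ε j →
      0 < ∑ j ∈ Finset.Icc 1 i', ε j) ∧
    (∃ i, i ≤ J ∧ 1 < ∑ j ∈ Finset.Icc 1 i, ε j)}

/-- The integers `∑_{j=1}^J ε j * k j` with `∑ ε j = s`, nonnegative partial sums of `ε`, and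
partial sums that stay positive once they are positive. -/
def PathSet (J : ℕ) (k : ℕ → ℤ) (s : ℤ) : Set ℤ :=
  {m | ∃ ε : ℕ → ℤ,
    m = ∑ j ∈ Finset.Icc 1 J, ε j * k j ∧
    (∑ j ∈ Finset.Icc 1 J, ε j) = s ∧
    (∀ i, i ≤ J → 0 ≤ ∑ j ∈ Finset.Icc 1 i, ε j) ∧
    (∀ i i', i ≤ i' → i' ≤ J → 0 < ∑ j ∈ Finset.Icc 1 i, ε j →
      0 < ∑ j ∈ Finset.Icc 1 i', ε j)}

lemma add_mem_pathSet {J : ℕ} {k : ℕ → ℤ} {s t m n : ℤ} (hm : m ∈ PathSet J k s)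
    (hn : n ∈ PathSet J k t) : m + n ∈ PathSet J k (s + t) := by
  obtain ⟨ε, rfl, rfl, h0, hp⟩ := hm
  obtain ⟨δ, rfl, rfl, h0', hp'⟩ := hn
  refine ⟨fun j => ε j + δ j, ?_, Finset.sum_add_distrib, fun i hi => ?_, fun i i' hii hi' h => ?_⟩
  · simp [add_mul, Finset.sum_add_distrib]
  · rw [Finset.sum_add_distrib]
    exact add_nonneg (h0 i hi) (h0' i hi)
  · rw [Finset.sum_add_distrib] at h ⊢
    have a := h0 i' hi'
    have b := h0' i' hi'
    by_cases hε : 0 < ∑ j ∈ Finset.Icc 1 i, ε j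
    · linarith [hp i i' hii hi' hε]
    · linarith [hp' i i' hii hi' (by linarith)]

lemma sum_Icc_update_of_le {R : Type*} [AddCommMonoid R] (ε : ℕ → ℤ) (g : ℕ → ℤ → R) (a : ℤ)
    {i J : ℕ} (hi : i ≤ J) :
    ∑ j ∈ Finset.Icc 1 i, g j (Function.update ε (J + 1) a j) =
      ∑ j ∈ Finset.Icc 1 i, g j (ε j) := by
  refine Finset.sum_congr rfl fun j hj => ?_
  rw [Function.update_of_ne]
  have := (Finset.mem_Icc.mp hj).2
  omega

lemma add_mul_mem_pathSet_succ {J : ℕ} {k : ℕ → ℤ} {s a m : ℤ} (hm : m ∈ PathSet J k s)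
    (hsa : 0 < s + a) : m + a * k (J + 1) ∈ PathSet (J + 1) k (s + a) := by
  obtain ⟨ε, rfl, rfl, h0, hp⟩ := hm
  have hle : ∀ i ≤ J, ∑ j ∈ Finset.Icc 1 i, Function.update ε (J + 1) a j =
      ∑ j ∈ Finset.Icc 1 i, ε j := fun i hi => sum_Icc_update_of_le ε (fun _ x => x) a hi
  have htot : ∑ j ∈ Finset.Icc 1 (J + 1), Function.update ε (J + 1) a j =
      ∑ j ∈ Finset.Icc 1 J, ε j + a := by
    rw [Finset.sum_Icc_succ_top (by omega), hle J le_rfl, Function.update_self]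
  refine ⟨Function.update ε (J + 1) a, ?_, htot, fun i hi => ?_, fun i i' hii hi' h => ?_⟩
  · rw [Finset.sum_Icc_succ_top (by omega),
      sum_Icc_update_of_le ε (fun j x => x * k j) a le_rfl, Function.update_self]
  · rcases hi.eq_or_lt with rfl | hi
    · rw [htot]; exact hsa.le
    · rw [hle i (by omega)]; exact h0 i (by omega)
  · rcases hi'.eq_or_lt with rfl | hi'
    · rwa [htot]
    · rw [hle i (by omega)] at h
      rw [hle i' (by omega)]
      exact hp i i' hii (by omega) h

lemma zero_mem_pathSet (J : ℕ) (k : ℕ → ℤ) : 0 ∈ PathSet J k 0 :=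
  ⟨0, by simp⟩

lemma add_mul_mem_schurSet_succ {J : ℕ} {k : ℕ → ℤ} {s m : ℤ} (hs : 1 < s)
    (hm : m ∈ PathSet J k s) : m + (1 - s) * k (J + 1) ∈ SchurSet (J + 1) k := by
  obtain ⟨ε, rfl, rfl, h0, hp⟩ := hm
  have hle : ∀ i ≤ J, ∑ j ∈ Finset.Icc 1 i,
      Function.update ε (J + 1) (1 - ∑ j ∈ Finset.Icc 1 J, ε j) j =
      ∑ j ∈ Finset.Icc 1 i, ε j := fun i hi => sum_Icc_update_of_le ε (fun _ x => x) _ hi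
  have htot : ∑ j ∈ Finset.Icc 1 (J + 1),
      Function.update ε (J + 1) (1 - ∑ j ∈ Finset.Icc 1 J, ε j) j = 1 := by
    rw [Finset.sum_Icc_succ_top (by omega), hle J le_rfl, Function.update_self]
    ring
  refine ⟨Function.update ε (J + 1) (1 - ∑ j ∈ Finset.Icc 1 J, ε j), ?_, htot,
    fun i hi => ?_, fun i i' hii hi' h => ?_, J, by omega, by rwa [hle J le_rfl]⟩
  · rw [Finset.sum_Icc_succ_top (by omega),
      sum_Icc_update_of_le ε (fun j x => x * k j) _ le_rfl, Function.update_self]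
  · rcases hi.eq_or_lt with rfl | hi
    · rw [htot]; exact zero_le_one
    · rw [hle i (by omega)]; exact h0 i (by omega)
  · rcases hi'.eq_or_lt with rfl | hi'
    · rw [htot]; exact zero_lt_one
    · rw [hle i (by omega)] at h
      rw [hle i' (by omega)]
      exact hp i i' hii (by omega) h

lemma schurSet_subset_succ (J : ℕ) (k : ℕ → ℤ) : SchurSet J k ⊆ SchurSet (J + 1) k := by
  rintro _ ⟨ε, rfl, h1, h0, hp, i₀, hi₀, hlt⟩
  have hle : ∀ i ≤ J, ∑ j ∈ Finset.Icc 1 i, Function.update ε (J + 1) 0 j =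
      ∑ j ∈ Finset.Icc 1 i, ε j := fun i hi => sum_Icc_update_of_le ε (fun _ x => x) _ hi
  have htot : ∑ j ∈ Finset.Icc 1 (J + 1), Function.update ε (J + 1) 0 j = 1 := by
    rw [Finset.sum_Icc_succ_top (by omega), hle J le_rfl, Function.update_self, h1, add_zero]
  refine ⟨Function.update ε (J + 1) 0, ?_, htot,
    fun i hi => ?_, fun i i' hii hi' h => ?_, i₀, by omega, by rwa [hle i₀ hi₀]⟩
  · rw [Finset.sum_Icc_succ_top (by omega),
      sum_Icc_update_of_le ε (fun j x => x * k j) _ le_rfl, Function.update_self, zero_mul,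
      add_zero]
  · rcases hi.eq_or_lt with rfl | hi
    · rw [htot]; exact zero_le_one
    · rw [hle i (by omega)]; exact h0 i (by omega)
  · rcases hi'.eq_or_lt with rfl | hi'
    · rw [htot]; exact zero_lt_one
    · rw [hle i (by omega)] at h
      rw [hle i' (by omega)]
      exact hp i i' hii (by omega) h

/-- The continuous functions on the circle that are uniform limits of linear combinations of the
characters `fourier (-m)`, `m ∈ A`. -/
noncomputable def spectralSubspace (T : ℝ) [Fact (0 < T)] (A : Set ℤ) :
    Submodule ℂ C(AddCircle T, ℂ) :=
  (Submodule.span ℂ ((fun m : ℤ => fourier (-m)) '' A)).topologicalClosure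

lemma fourier_mul_fourier {T : ℝ} (m n : ℤ) :
    (fourier m : C(AddCircle T, ℂ)) * fourier n = fourier (m + n) :=
  ContinuousMap.ext fun _ => fourier_add.symm

section spectralSubspace

variable {T : ℝ} [hT : Fact (0 < T)]

lemma fourier_mem_spectralSubspace {A : Set ℤ} {m : ℤ} (hm : m ∈ A) :
    fourier (-m) ∈ spectralSubspace T A :=
  Submodule.le_topologicalClosure _ (Submodule.subset_span ⟨m, hm, rfl⟩)

lemma mul_mem_spectralSubspace {A B C : Set ℤ} (hABC : ∀ a ∈ A, ∀ b ∈ B, a + b ∈ C)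
    {f g : C(AddCircle T, ℂ)} (hf : f ∈ spectralSubspace T A) (hg : g ∈ spectralSubspace T B) :
    f * g ∈ spectralSubspace T C := by
  refine map_mem_closure₂ continuous_mul hf hg fun a ha b hb => ?_
  have hab := Submodule.mul_mem_mul ha hb
  rw [Submodule.span_mul_span] at hab
  refine Submodule.span_mono ?_ hab
  rintro _ ⟨_, ⟨m, hm, rfl⟩, _, ⟨n, hn, rfl⟩, rfl⟩
  refine ⟨m + n, hABC m hm n hn, ?_⟩
  simp only [fourier_mul_fourier, neg_add]

lemma map_eq_zero_of_mem_spectralSubspace {A : Set ℤ} (φ : C(AddCircle T, ℂ) →L[ℂ] ℂ)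
    (hφ : ∀ m ∈ A, φ (fourier (-m)) = 0) {f : C(AddCircle T, ℂ)}
    (hf : f ∈ spectralSubspace T A) : φ f = 0 := by
  have hle : spectralSubspace T A ≤ φ.toLinearMap.ker := by
    refine Submodule.topologicalClosure_minimal _ (Submodule.span_le.mpr ?_) φ.isClosed_ker
    rintro _ ⟨m, hm, rfl⟩
    exact hφ m hm
  exact hle hf

lemma pow_mem_spectralSubspace_pathSet {J : ℕ} {k : ℕ → ℤ} {G : C(AddCircle T, ℂ)}
    (hG : G ∈ spectralSubspace T (PathSet J k 1)) (n : ℕ) :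
    G ^ n ∈ spectralSubspace T (PathSet J k n) := by
  induction n with
  | zero =>
    have h : (1 : C(AddCircle T, ℂ)) = fourier (-0) := by ext x; simp
    rw [pow_zero, h]
    exact fourier_mem_spectralSubspace (zero_mem_pathSet J k)
  | succ n ih =>
    rw [pow_succ]
    refine mul_mem_spectralSubspace (fun a ha b hb => ?_) ih hG
    push_cast
    exact add_mem_pathSet ha hb

end spectralSubspace

lemma Complex.norm_add_le_norm_one_add_conj_mul {γ w : ℂ} (hγ : ‖γ‖ ≤ 1) (hw : ‖w‖ ≤ 1) :
    ‖γ + w‖ ≤ ‖1 + (starRingEnd ℂ) γ * w‖ := by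
  refine le_of_sq_le_sq ?_ (norm_nonneg _)
  have h1 : ‖γ‖ ^ 2 ≤ 1 := pow_le_one₀ (norm_nonneg _) hγ
  have h2 : ‖w‖ ^ 2 ≤ 1 := pow_le_one₀ (norm_nonneg _) hw
  rw [← Complex.normSq_eq_norm_sq, Complex.normSq_apply] at h1 h2 ⊢
  rw [← Complex.normSq_eq_norm_sq, Complex.normSq_apply]
  simp only [Complex.add_re, Complex.add_im, Complex.mul_re, Complex.mul_im, Complex.one_re,
    Complex.one_im, Complex.conj_re, Complex.conj_im]
  nlinarith [mul_nonneg (sub_nonneg.mpr h1) (sub_nonneg.mpr h2)]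

/-- The Möbius step of Schur's algorithm, for continuous functions: `u` is unimodular with inverse
`v`, and the function is `u (γ + v G) / (1 + conj γ v G)` in power series form. -/
lemma norm_schur_step_le {X : Type*} [TopologicalSpace X] [CompactSpace X] {γ : ℂ} (hγ : ‖γ‖ < 1)
    {u v G : C(X, ℂ)} (huv : u * v = 1) (hu : ∀ x, ‖u x‖ = 1) (hG : ‖G‖ ≤ 1)
    {S : C(X, ℂ)} (hS : (1 - (-(starRingEnd ℂ) γ) • (v * G)) * S = 1) :
    ‖γ • u + (1 - (‖γ‖ : ℂ) ^ 2) • (G * S)‖ ≤ 1 := by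
  refine (ContinuousMap.norm_le _ zero_le_one).mpr fun x => ?_
  have huvx : u x * v x = 1 := by simpa using DFunLike.congr_fun huv x
  have hSx : (1 + (starRingEnd ℂ) γ * (v x * G x)) * S x = 1 := by
    simpa using DFunLike.congr_fun hS x
  have hvx : ‖v x‖ = 1 := by simpa [hu x] using congrArg norm huvx
  have hw : ‖v x * G x‖ ≤ 1 := by
    rw [norm_mul, hvx, one_mul]
    exact (G.norm_coe_le_norm x).trans hG
  have hγγ : (starRingEnd ℂ) γ * γ = (‖γ‖ : ℂ) ^ 2 := Complex.conj_mul' γ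
  have key : γ * u x + (1 - (‖γ‖ : ℂ) ^ 2) * (G x * S x) = u x * ((γ + v x * G x) * S x) := by
    rw [← hγγ]
    linear_combination (-γ * u x) * hSx + (-(G x * S x) + (starRingEnd ℂ) γ * γ * G x * S x) * huvx
  have hle := Complex.norm_add_le_norm_one_add_conj_mul hγ.le hw
  have hn := congrArg norm hSx
  rw [norm_mul, norm_one] at hn
  simp only [ContinuousMap.add_apply, ContinuousMap.smul_apply, ContinuousMap.mul_apply,
    smul_eq_mul]
  rw [key, norm_mul, hu x, one_mul, norm_mul, ← hn]
  exact mul_le_mul_of_nonneg_right hle (norm_nonneg _)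

lemma exists_norm_le_one_of_schurSet {T : ℝ} [hT : Fact (0 < T)]
    (φ : C(AddCircle T, ℂ) →L[ℂ] ℂ) (γ : ℕ → ℂ) (hγ : ∀ j, ‖γ j‖ < 1) (k : ℕ → ℤ) (c : ℂ)
    (J : ℕ) (hc : ∀ j ∈ Finset.Icc 1 J, γ j * φ (fourier (-k j)) = c * (‖γ j‖ : ℂ) ^ 2)
    (hφ : ∀ m ∈ SchurSet J k, φ (fourier (-m)) = 0) :
    ∃ G ∈ spectralSubspace T (PathSet J k 1), ‖G‖ ≤ 1 ∧
      φ G = c * (1 - ∏ j ∈ Finset.Icc 1 J, (1 - (‖γ j‖ : ℂ) ^ 2)) := by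
  induction J with
  | zero => exact ⟨0, zero_mem _, by simp, by simp⟩
  | succ J ih =>
    obtain ⟨G, hGs, hG, hφG⟩ := ih
      (fun j hj => hc j (Finset.Icc_subset_Icc_right J.le_succ hj))
      (fun m hm => hφ m (schurSet_subset_succ J k hm))
    set κ := k (J + 1)
    set g := γ (J + 1)
    set u : C(AddCircle T, ℂ) := fourier (-κ) with hu
    set v : C(AddCircle T, ℂ) := fourier κ with hv
    have huv : u * v = 1 := by
      rw [hu, hv, fourier_mul_fourier]
      ext x
      simp
    set y : C(AddCircle T, ℂ) := (-(starRingEnd ℂ) g) • (v * G) with hy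
    have hvn : ‖v‖ ≤ 1 := (fourier_norm κ).le
    have hy1 : ‖y‖ < 1 := by
      rw [hy, norm_smul, norm_neg, RCLike.norm_conj]
      refine lt_of_le_of_lt ?_ (hγ (J + 1))
      refine mul_le_of_le_one_right (norm_nonneg _) ((norm_mul_le _ _).trans ?_)
      exact mul_le_one₀ hvn (norm_nonneg _) hG
    have hsum : Summable fun n : ℕ => y ^ n := summable_geometric_of_norm_lt_one hy1
    have hS : (1 - y) * ∑' n : ℕ, y ^ n = 1 := mul_neg_geom_series y hy1
    have hterm : ∀ n : ℕ, G * y ^ n =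
        (-(starRingEnd ℂ) g) ^ n • (G ^ (n + 1) * fourier (-(-(n : ℤ) * κ))) := by
      intro n
      ext x
      simp only [hy, hv, ContinuousMap.mul_apply, ContinuousMap.pow_apply,
        ContinuousMap.smul_apply, smul_eq_mul, neg_mul, neg_neg]
      have : fourier ((n : ℤ) * κ) x = fourier κ x ^ n := by
        simp only [fourier_apply, ← smul_smul, natCast_zsmul, toCircle_nsmul, Circle.coe_pow]
      rw [this]
      ring
    have hshift : ∀ n : ℕ, ∀ {C : Set ℤ},
        (∀ m ∈ PathSet J k (n + 1), m + -(n : ℤ) * κ ∈ C) → G * y ^ n ∈ spectralSubspace T C := by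
      intro n C hC
      rw [hterm]
      refine Submodule.smul_mem _ _ (mul_mem_spectralSubspace
        (B := {-(n : ℤ) * κ}) (fun a ha b hb => ?_)
        (pow_mem_spectralSubspace_pathSet hGs (n + 1)) (fourier_mem_spectralSubspace rfl))
      rw [Set.mem_singleton_iff.mp hb]
      exact hC a (by exact_mod_cast ha)
    have hpath : ∀ n : ℕ, G * y ^ n ∈ spectralSubspace T (PathSet (J + 1) k 1) := by
      refine fun n => hshift n fun m hm => ?_
      simpa using add_mul_mem_pathSet_succ (a := -(n : ℤ)) hm (by simp)
    have hzero : ∀ n : ℕ, φ (G * y ^ (n + 1)) = 0 := by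
      refine fun n => map_eq_zero_of_mem_spectralSubspace φ hφ (hshift _ fun m hm => ?_)
      have := add_mul_mem_schurSet_succ (by push_cast; omega) hm
      convert this using 3
      push_cast
      ring
    have hGsum : Summable fun n : ℕ => G * y ^ n := hsum.mul_left G
    refine ⟨g • u + (1 - (‖g‖ : ℂ) ^ 2) • (G * ∑' n : ℕ, y ^ n), ?_, ?_, ?_⟩
    · refine add_mem (Submodule.smul_mem _ _ (fourier_mem_spectralSubspace ?_))
        (Submodule.smul_mem _ _ ?_)
      · simpa using add_mul_mem_pathSet_succ (a := 1) (zero_mem_pathSet J k) (by simp)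
      · rw [← hsum.tsum_mul_left]
        exact (Submodule.isClosed_topologicalClosure _).mem_of_tendsto hGsum.hasSum
          (Filter.Eventually.of_forall fun s => sum_mem fun n _ => hpath n)
    · exact norm_schur_step_le (hγ (J + 1)) huv (fun x => Circle.norm_coe _) hG hS
    · have hφS : φ (G * ∑' n : ℕ, y ^ n) = φ G := by
        rw [← hsum.tsum_mul_left, φ.map_tsum hGsum, (φ.summable hGsum).tsum_eq_zero_add]
        simp [hzero]
      rw [map_add, map_smul, map_smul, hφS, hφG, smul_eq_mul, smul_eq_mul,
        hc (J + 1) (by simp), Finset.prod_Icc_succ_top (by omega)]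
      ring

/-- Integration against an integrable function, as a functional on continuous functions. -/
noncomputable def integralPairing {T : ℝ} [hT : Fact (0 < T)] (f : AddCircle T → ℂ)
    (hf : Integrable f haarAddCircle) : C(AddCircle T, ℂ) →L[ℂ] ℂ :=
  have hint (g : C(AddCircle T, ℂ)) : Integrable (fun t => g t * f t) haarAddCircle :=
    hf.bdd_mul g.continuous.aestronglyMeasurable (Filter.Eventually.of_forall g.norm_coe_le_norm)
  LinearMap.mkContinuous
    { toFun := fun g => ∫ t, g t * f t ∂haarAddCircle
      map_add' := fun g h => by
        simp only [ContinuousMap.add_apply, add_mul]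
        exact integral_add (hint g) (hint h)
      map_smul' := fun a g => by
        simp only [ContinuousMap.smul_apply, smul_eq_mul, mul_assoc, RingHom.id_apply]
        exact integral_const_mul a _ }
    (∫ t, ‖f t‖ ∂haarAddCircle)
    (fun g => by
      rw [mul_comm, ← integral_const_mul]
      refine norm_integral_le_of_norm_le (hf.norm.const_mul _)
        (Filter.Eventually.of_forall fun t => ?_)
      rw [norm_mul]
      exact mul_le_mul_of_nonneg_right (g.norm_coe_le_norm t) (norm_nonneg _))

lemma integralPairing_fourier {T : ℝ} [hT : Fact (0 < T)] (f : AddCircle T → ℂ)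
    (hf : Integrable f haarAddCircle) (m : ℤ) :
    integralPairing f hf (fourier (-m)) = fourierCoeff f m := rfl

lemma norm_integralPairing_le {T : ℝ} [hT : Fact (0 < T)] (f : AddCircle T → ℂ)
    (hf : Integrable f haarAddCircle) :
    ‖integralPairing f hf‖ ≤ ∫ t, ‖f t‖ ∂haarAddCircle :=
by
  unfold integralPairing
  exact LinearMap.mkContinuous_norm_le _ (integral_nonneg fun _ => norm_nonneg _) _

lemma prod_one_sub_le_exp_neg_sum {ι : Type*} (s : Finset ι) {x : ι → ℝ}
    (hx : ∀ i ∈ s, x i ≤ 1) : ∏ i ∈ s, (1 - x i) ≤ Real.exp (-∑ i ∈ s, x i) := by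
  rw [← Finset.sum_neg_distrib, Real.exp_sum]
  exact Finset.prod_le_prod (fun i hi => sub_nonneg.mpr (hx i hi))
    fun i _ => Real.one_sub_le_exp_neg (x i)

/-- Theorem 5 of the paper: for any finite sequence `(k j)_{j=1}^J` of integers, if `f̂` vanishes
on `SchurSet J k`, then `(∑_{j=1}^J |f̂(k j)|²)^{1/2} ≤ 2 ‖f‖₁`. No lacunarity or ordering of
the sequence is assumed. -/
theorem paley_schur {T : ℝ} [hT : Fact (0 < T)]
    (f : AddCircle T → ℂ) (hf : Integrable f haarAddCircle)
    (J : ℕ) (k : ℕ → ℤ)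
    (hvanish : ∀ m ∈ SchurSet J k, fourierCoeff f m = 0) :
    Real.sqrt (∑ j ∈ Finset.Icc 1 J, ‖fourierCoeff f (k j)‖ ^ 2) ≤
      2 * ∫ t, ‖f t‖ ∂haarAddCircle := by
  set B := Real.sqrt (∑ j ∈ Finset.Icc 1 J, ‖fourierCoeff f (k j)‖ ^ 2)
  have hBsq : B ^ 2 = ∑ j ∈ Finset.Icc 1 J, ‖fourierCoeff f (k j)‖ ^ 2 :=
    Real.sq_sqrt (Finset.sum_nonneg fun _ _ => sq_nonneg _)
  have hI : 0 ≤ ∫ t, ‖f t‖ ∂haarAddCircle := integral_nonneg fun _ => norm_nonneg _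
  rcases (show 0 ≤ B from Real.sqrt_nonneg _).eq_or_lt with hB0 | hB0
  · rw [← hB0]
    positivity
  -- The factor `4 / 5` keeps every `γ j` strictly inside the unit disc.
  let γ : ℕ → ℂ := fun j => if j ∈ Finset.Icc 1 J then
    (4 / 5 / B : ℝ) * (starRingEnd ℂ) (fourierCoeff f (k j)) else 0
  have hγ_mem : ∀ j ∈ Finset.Icc 1 J, γ j =
      (4 / 5 / B : ℝ) * (starRingEnd ℂ) (fourierCoeff f (k j)) := fun j hj => if_pos hj
  have hγ_norm : ∀ j ∈ Finset.Icc 1 J, ‖γ j‖ = 4 / 5 / B * ‖fourierCoeff f (k j)‖ := by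
    intro j hj
    rw [hγ_mem j hj, norm_mul, RCLike.norm_conj, Complex.norm_of_nonneg (by positivity)]
  have hγ : ∀ j, ‖γ j‖ < 1 := by
    intro j
    by_cases hj : j ∈ Finset.Icc 1 J
    · have hle : ‖fourierCoeff f (k j)‖ ≤ B := by
        refine Real.le_sqrt_of_sq_le ?_
        exact Finset.single_le_sum (f := fun j => ‖fourierCoeff f (k j)‖ ^ 2)
          (fun _ _ => sq_nonneg _) hj
      rw [hγ_norm j hj, div_mul_eq_mul_div, div_lt_one hB0]
      linarith
    · simp only [γ, if_neg hj, norm_zero, zero_lt_one]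
  have hsum : ∑ j ∈ Finset.Icc 1 J, ‖γ j‖ ^ 2 = 16 / 25 := by
    rw [Finset.sum_congr rfl fun j hj => by rw [hγ_norm j hj, mul_pow], ← Finset.mul_sum, ← hBsq]
    rw [← mul_pow, div_mul_cancel₀ _ hB0.ne']
    norm_num
  obtain ⟨G, -, hG, hφG⟩ := exists_norm_le_one_of_schurSet (integralPairing f hf) γ hγ k
    ((5 / 4 * B : ℝ) : ℂ) J
    (fun j hj => by
      rw [integralPairing_fourier, hγ_norm j hj, hγ_mem j hj, mul_assoc, Complex.conj_mul']
      have : (B : ℂ) ≠ 0 := by exact_mod_cast hB0.ne'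
      push_cast
      field_simp)
    (fun m hm => by rw [integralPairing_fourier]; exact hvanish m hm)
  have hprod : ∏ j ∈ Finset.Icc 1 J, (1 - ‖γ j‖ ^ 2) ≤ 3 / 5 := by
    refine (prod_one_sub_le_exp_neg_sum _
      fun j _ => pow_le_one₀ (norm_nonneg _) (hγ j).le).trans ?_
    rw [hsum, Real.exp_neg]
    refine inv_le_of_inv_le₀ (by norm_num) (le_trans ?_
      (Real.quadratic_le_exp_of_nonneg (x := 16 / 25) (by norm_num)))
    norm_num
  have hre : integralPairing f hf G =
      ((5 / 4 * B * (1 - ∏ j ∈ Finset.Icc 1 J, (1 - ‖γ j‖ ^ 2)) : ℝ) : ℂ) := by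
    rw [hφG]
    push_cast
    rfl
  have hle : ‖integralPairing f hf G‖ ≤ ∫ t, ‖f t‖ ∂haarAddCircle :=
    ((integralPairing f hf).le_of_opNorm_le (norm_integralPairing_le f hf) G).trans
      (mul_le_of_le_one_right hI hG)
  rw [hre, Complex.norm_real] at hle
  have := (Real.le_norm_self _).trans hle
  nlinarith
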